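/- If the continued fraction expansion of √f has odd period 2m+1, then the fundamental solution (c, h) of c² − f·h² = 1 satisfies c = 2(AₘBₘ + A_{m−1}B_{m−1})² + 1 and h = 2(AₘBₘ + A_{m−1}B_{m−1})(Bₘ² + B_{m−1}²), where Aₖ/Bₖ are the convergents of √f. -/

import Mathlib

/-- The pair `(rₖ, sₖ)` of the continued fraction algorithm for `√f`:
`r₀ = 0`, `s₀ = 1`, `r_{k+1} = aₖ sₖ − rₖ`, `s_{k+1} = (f − r_{k+1}²)/sₖ`,
where `aₖ = ⌊(√f + rₖ)/sₖ⌋ = ⌊(⌊√f⌋ + rₖ)/sₖ⌋`. -/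
def cfRS (f : ℕ) : ℕ → ℤ × ℤ
  | 0 => (0, 1)
  | k + 1 =>
    let p := cfRS f k
    let a := Int.fdiv ((Nat.sqrt f : ℤ) + p.1) p.2
    let r' := a * p.2 - p.1
    (r', Int.fdiv ((f : ℤ) - r' ^ 2) p.2)

/-- The `k`-th partial quotient `aₖ` of the continued fraction of `√f`. -/
def cfA (f : ℕ) (k : ℕ) : ℤ :=
  Int.fdiv ((Nat.sqrt f : ℤ) + (cfRS f k).1) (cfRS f k).2

/-- Numerators of the convergents of `√f`, shifted by 2:
`cfNum f (k+2) = Aₖ`, with `A₋₂ = 0`, `A₋₁ = 1`. -/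
def cfNum (f : ℕ) : ℕ → ℤ
  | 0 => 0
  | 1 => 1
  | k + 2 => cfA f k * cfNum f (k + 1) + cfNum f k

/-- Denominators of the convergents of `√f`, shifted by 2:
`cfDen f (k+2) = Bₖ`, with `B₋₂ = 1`, `B₋₁ = 0`. -/
def cfDen (f : ℕ) : ℕ → ℤ
  | 0 => 1
  | 1 => 0
  | k + 2 => cfA f k * cfDen f (k + 1) + cfDen f k

/-- `p` is a period of the (eventually periodic) partial quotient sequence of `√f`. -/
def CFIsPeriod (f p : ℕ) : Prop :=
  0 < p ∧ ∀ k, 1 ≤ k → cfA f (k + p) = cfA f k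

/-- `p` is the (minimal) period of the continued fraction expansion of `√f`. -/
def CFPeriod (f p : ℕ) : Prop :=
  CFIsPeriod f p ∧ ∀ q, CFIsPeriod f q → p ≤ q

/-- `(c, h)` is the fundamental (smallest positive) solution of `c² − f h² = 1`. -/
def IsFundamentalPell (f : ℕ) (c h : ℤ) : Prop :=
  0 < c ∧ 0 < h ∧ c ^ 2 - (f : ℤ) * h ^ 2 = 1 ∧
    ∀ c' h' : ℤ, 0 < c' → 0 < h' → c' ^ 2 - (f : ℤ) * h' ^ 2 = 1 → c ≤ c'

theorem cfRS_succ_fst (f k : ℕ) :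
    (cfRS f (k + 1)).1 = cfA f k * (cfRS f k).2 - (cfRS f k).1 := rfl

theorem cfRS_succ_snd (f k : ℕ) :
    (cfRS f (k + 1)).2 = Int.fdiv ((f : ℤ) - (cfRS f (k + 1)).1 ^ 2) (cfRS f k).2 := rfl

/-- If `s > 0`, then `⌊x / s⌋ = a` is characterised by `a s ≤ x < a s + s`. -/
theorem Int.fdiv_eq_iff_of_pos {x s a : ℤ} (hs : 0 < s) :
    Int.fdiv x s = a ↔ a * s ≤ x ∧ x < a * s + s := by
  rw [Int.fdiv_eq_ediv_of_nonneg _ hs.le, Int.ediv_eq_iff_of_pos hs]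

theorem cfA_bounds {f k : ℕ} (hs : 0 < (cfRS f k).2) :
    cfA f k * (cfRS f k).2 ≤ (Nat.sqrt f : ℤ) + (cfRS f k).1 ∧
      (Nat.sqrt f : ℤ) + (cfRS f k).1 < cfA f k * (cfRS f k).2 + (cfRS f k).2 :=
  (Int.fdiv_eq_iff_of_pos hs).1 rfl

theorem natSqrt_sq_lt {f : ℕ} (hns : ¬ IsSquare f) : (Nat.sqrt f : ℤ) ^ 2 < f := by
  have h1 : Nat.sqrt f * Nat.sqrt f ≤ f := Nat.sqrt_le f
  have h2 : Nat.sqrt f * Nat.sqrt f ≠ f := fun h => hns ⟨_, h.symm⟩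
  have h3 : Nat.sqrt f * Nat.sqrt f < f := lt_of_le_of_ne h1 h2
  zify at h3
  linarith [sq (Nat.sqrt f : ℤ)]

theorem lt_natSqrt_succ_sq (f : ℕ) : (f : ℤ) < ((Nat.sqrt f : ℤ) + 1) ^ 2 := by
  have h := Nat.lt_succ_sqrt f
  zify at h
  linarith [sq ((Nat.sqrt f : ℤ) + 1)]

theorem two_le_of_not_isSquare {f : ℕ} (hf : 0 < f) (hns : ¬ IsSquare f) : 2 ≤ f := by
  by_contra h
  obtain rfl : f = 1 := by omega
  exact hns ⟨1, rfl⟩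

theorem natSqrt_pos_int {f : ℕ} (hf : 0 < f) : (0 : ℤ) < Nat.sqrt f := by
  exact_mod_cast Nat.sqrt_pos.2 hf

/-- If `s ∣ f - r²`, then the algorithm performs an exact division. -/
theorem cfRS_mul_succ_of_dvd {f k : ℕ}
    (hd : (cfRS f k).2 ∣ (f : ℤ) - (cfRS f k).1 ^ 2) :
    (cfRS f k).2 * (cfRS f (k + 1)).2 = (f : ℤ) - (cfRS f (k + 1)).1 ^ 2 := by
  rw [cfRS_succ_snd]
  refine Int.mul_fdiv_cancel' ?_
  obtain ⟨t, ht⟩ := hd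
  refine ⟨t - cfA f k ^ 2 * (cfRS f k).2 + 2 * cfA f k * (cfRS f k).1, ?_⟩
  rw [cfRS_succ_fst]
  linear_combination ht

/-- From the first step on, the pairs of the algorithm are reduced. -/
theorem cfRS_reduced {f : ℕ} (hf : 0 < f) (hns : ¬ IsSquare f) (k : ℕ) :
    (0 < (cfRS f (k + 1)).2 ∧
      (cfRS f (k + 1)).2 ∣ (f : ℤ) - (cfRS f (k + 1)).1 ^ 2) ∧
    (cfRS f (k + 1)).1 ≤ Nat.sqrt f ∧
    (Nat.sqrt f : ℤ) < (cfRS f (k + 1)).1 + (cfRS f (k + 1)).2 ∧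
    (cfRS f (k + 1)).2 ≤ Nat.sqrt f + (cfRS f (k + 1)).1 ∧
    0 < (cfRS f (k + 1)).1 := by
  have hd1 := natSqrt_sq_lt hns
  have hd2 := lt_natSqrt_succ_sq f
  have hd0 := natSqrt_pos_int hf
  induction k with
  | zero =>
    have h1 : (cfRS f 1).1 = Nat.sqrt f := by simp [cfRS]
    have h2 : (cfRS f 1).2 = f - (Nat.sqrt f : ℤ) ^ 2 := by simp [cfRS]
    rw [zero_add, h1, h2]
    exact ⟨⟨by linarith, dvd_rfl⟩, le_rfl, by linarith, by linarith, hd0⟩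
  | succ k ih =>
    obtain ⟨⟨hs, hdvd⟩, hr, hrs, hsr, -⟩ := ih
    have hmul := cfRS_mul_succ_of_dvd hdvd
    have hb := cfA_bounds hs
    have hr' := cfRS_succ_fst f (k + 1)
    set d : ℤ := (Nat.sqrt f : ℤ)
    set s := (cfRS f (k + 1)).2
    set r := (cfRS f (k + 1)).1
    set s' := (cfRS f (k + 1 + 1)).2
    set r' := (cfRS f (k + 1 + 1)).1
    set a := cfA f (k + 1)
    have ha : 0 < a := by
      by_contra h
      nlinarith
    have has : s ≤ a * s := by nlinarith
    have h1 : r' ≤ d := by linarith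
    have h2 : d < r' + s := by linarith
    have h3 : s ≤ d + r' := by linarith
    have h4 : 0 < r' := by linarith
    have hs' : 0 < s' := by
      by_contra h
      nlinarith
    refine ⟨⟨hs', ⟨s, by rw [← hmul]; ring⟩⟩, h1, ?_, ?_, h4⟩
    · by_contra h
      nlinarith
    · by_contra h
      nlinarith

theorem cfRS_snd_pos_dvd {f : ℕ} (hf : 0 < f) (hns : ¬ IsSquare f) (k : ℕ) :
    0 < (cfRS f k).2 ∧ (cfRS f k).2 ∣ (f : ℤ) - (cfRS f k).1 ^ 2 := by
  cases k with
  | zero => simp [cfRS]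
  | succ k => exact (cfRS_reduced hf hns k).1

theorem cfRS_mul_succ {f : ℕ} (hf : 0 < f) (hns : ¬ IsSquare f) (k : ℕ) :
    (cfRS f k).2 * (cfRS f (k + 1)).2 = (f : ℤ) - (cfRS f (k + 1)).1 ^ 2 :=
  cfRS_mul_succ_of_dvd (cfRS_snd_pos_dvd hf hns k).2

theorem cfA_pos {f : ℕ} (hf : 0 < f) (hns : ¬ IsSquare f) (k : ℕ) : 0 < cfA f k := by
  have hb := cfA_bounds (cfRS_snd_pos_dvd hf hns k).1
  have hs := (cfRS_snd_pos_dvd hf hns k).1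
  have hle : (cfRS f k).2 ≤ Nat.sqrt f + (cfRS f k).1 := by
    cases k with
    | zero => simpa [cfRS, Nat.one_le_iff_ne_zero, Nat.pos_iff_ne_zero] using natSqrt_pos_int hf
    | succ k => exact (cfRS_reduced hf hns k).2.2.2.1
  by_contra h
  nlinarith

/-- The partial quotient can be read off from the following remainder. -/
theorem cfA_eq_fdiv_succ {f : ℕ} (hf : 0 < f) (hns : ¬ IsSquare f) (k : ℕ) :
    cfA f (k + 1) =
      Int.fdiv ((Nat.sqrt f : ℤ) + (cfRS f (k + 2)).1) (cfRS f (k + 1)).2 := by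
  obtain ⟨⟨hs, -⟩, h1, h2, -⟩ := cfRS_reduced hf hns k
  have h := cfRS_succ_fst f (k + 1)
  refine ((Int.fdiv_eq_iff_of_pos hs).2 ⟨?_, ?_⟩).symm <;> rw [h] <;> linarith

theorem cfRS_one (f : ℕ) :
    cfRS f 1 = ((Nat.sqrt f : ℤ), (f : ℤ) - (Nat.sqrt f : ℤ) ^ 2) := by
  simp [cfRS]

theorem cfRS_add_of_eq {f i j : ℕ} (h : cfRS f i = cfRS f j) (k : ℕ) :
    cfRS f (i + k) = cfRS f (j + k) := by
  induction k with
  | zero => exact h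
  | succ k ih => rw [← add_assoc, ← add_assoc, cfRS, cfRS, ih]

theorem cfRS_fst_of_snd_eq_one {f : ℕ} (hf : 0 < f) (hns : ¬ IsSquare f) {k : ℕ}
    (h : (cfRS f (k + 1)).2 = 1) : (cfRS f (k + 1)).1 = Nat.sqrt f := by
  obtain ⟨-, h1, h2, -⟩ := cfRS_reduced hf hns k
  rw [h] at h2
  omega

theorem cfIsPeriod_of_snd_eq_one {f : ℕ} (hf : 0 < f) (hns : ¬ IsSquare f) {k : ℕ}
    (h : (cfRS f (k + 1)).2 = 1) : CFIsPeriod f (k + 1) := by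
  have hr := cfRS_fst_of_snd_eq_one hf hns h
  have hA : cfA f (k + 1) = 2 * (Nat.sqrt f : ℤ) := by
    rw [cfA, h, hr, Int.fdiv_one]; ring
  have hr2 : (cfRS f (k + 2)).1 = Nat.sqrt f := by
    rw [cfRS_succ_fst f (k + 1), hA, h, hr]; ring
  have heq : cfRS f (k + 2) = cfRS f 1 := by
    rw [cfRS_one]
    refine Prod.ext hr2 ?_
    have := cfRS_mul_succ hf hns (k + 1)
    rw [h, one_mul] at this
    rw [this, hr2]
  refine ⟨k.succ_pos, fun j hj => ?_⟩
  obtain ⟨i, rfl⟩ := Nat.exists_eq_add_of_le hj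
  rw [show 1 + i + (k + 1) = k + 2 + i by ring, cfA, cfA, cfRS_add_of_eq heq]

/-- The complete quotients `(√f + rₖ) / sₖ`. -/
noncomputable def cfComplete (f k : ℕ) : ℝ := (√f + (cfRS f k).1) / (cfRS f k).2

theorem natSqrt_le_sqrt (f : ℕ) : ((Nat.sqrt f : ℤ) : ℝ) ≤ √f := by
  exact_mod_cast Real.nat_sqrt_le_real_sqrt

theorem sqrt_lt_natSqrt_succ (f : ℕ) : √f < ((Nat.sqrt f : ℤ) : ℝ) + 1 := by
  exact_mod_cast Real.real_sqrt_lt_nat_sqrt_succ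

theorem natSqrt_lt_sqrt {f : ℕ} (hns : ¬ IsSquare f) : ((Nat.sqrt f : ℤ) : ℝ) < √f := by
  refine Real.lt_sqrt_of_sq_lt ?_
  exact_mod_cast natSqrt_sq_lt hns

theorem floor_cfComplete {f : ℕ} (hf : 0 < f) (hns : ¬ IsSquare f) (k : ℕ) :
    ⌊cfComplete f k⌋ = cfA f k := by
  have hs := (cfRS_snd_pos_dvd hf hns k).1
  obtain ⟨h1, h2⟩ := cfA_bounds hs
  have hsR : (0 : ℝ) < (cfRS f k).2 := by exact_mod_cast hs
  have h1R : (cfA f k : ℝ) * (cfRS f k).2 ≤ ((Nat.sqrt f : ℤ) : ℝ) + (cfRS f k).1 := by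
    exact_mod_cast h1
  have h2R : ((Nat.sqrt f : ℤ) : ℝ) + (cfRS f k).1 + 1
      ≤ (cfA f k : ℝ) * (cfRS f k).2 + (cfRS f k).2 := by
    exact_mod_cast h2
  have h3 := natSqrt_le_sqrt f
  have h4 := sqrt_lt_natSqrt_succ f
  rw [Int.floor_eq_iff, cfComplete, le_div_iff₀ hsR, div_lt_iff₀ hsR]
  constructor <;> linarith

theorem cfComplete_sub {f : ℕ} (hf : 0 < f) (hns : ¬ IsSquare f) (k : ℕ) :
    (cfComplete f k - cfA f k)⁻¹ = cfComplete f (k + 1) := by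
  have hs : ((cfRS f k).2 : ℝ) ≠ 0 := by
    exact_mod_cast (cfRS_snd_pos_dvd hf hns k).1.ne'
  have hs' : ((cfRS f (k + 1)).2 : ℝ) ≠ 0 := by
    exact_mod_cast (cfRS_snd_pos_dvd hf hns (k + 1)).1.ne'
  have hr : ((cfRS f (k + 1)).1 : ℝ) = cfA f k * (cfRS f k).2 - (cfRS f k).1 := by
    exact_mod_cast cfRS_succ_fst f k
  have hm : ((cfRS f k).2 : ℝ) * (cfRS f (k + 1)).2 = f - ((cfRS f (k + 1)).1 : ℝ) ^ 2 := by
    exact_mod_cast cfRS_mul_succ hf hns k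
  have hsq : √(f : ℝ) ^ 2 = f := Real.sq_sqrt (Nat.cast_nonneg f)
  refine inv_eq_of_mul_eq_one_right ?_
  rw [cfComplete, cfComplete]
  field_simp
  linear_combination hsq - hm + (√(f : ℝ) + ((cfRS f (k + 1)).1 : ℝ)) * hr

theorem one_lt_cfComplete {f : ℕ} (hf : 0 < f) (hns : ¬ IsSquare f) (k : ℕ) :
    1 < cfComplete f (k + 1) := by
  obtain ⟨⟨hs, -⟩, -, -, h, -⟩ := cfRS_reduced hf hns k
  have hsR : (0 : ℝ) < (cfRS f (k + 1)).2 := by exact_mod_cast hs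
  have hR : ((cfRS f (k + 1)).2 : ℝ) ≤ ((Nat.sqrt f : ℤ) : ℝ) + (cfRS f (k + 1)).1 := by
    exact_mod_cast h
  rw [cfComplete, lt_div_iff₀ hsR]
  linarith [natSqrt_lt_sqrt hns]

theorem cfComplete_le {f : ℕ} (hf : 0 < f) (hns : ¬ IsSquare f) (k : ℕ) :
    cfComplete f (k + 1) ≤ 2 * √f := by
  obtain ⟨⟨hs, -⟩, h, -⟩ := cfRS_reduced hf hns k
  have hsR : (1 : ℝ) ≤ (cfRS f (k + 1)).2 := by exact_mod_cast hs
  have hR : ((cfRS f (k + 1)).1 : ℝ) ≤ ((Nat.sqrt f : ℤ) : ℝ) := by exact_mod_cast h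
  rw [cfComplete, div_le_iff₀ (by linarith)]
  nlinarith [natSqrt_le_sqrt f, Real.sqrt_nonneg (f : ℝ)]

/-- Two bounded sequences of complete quotients with the same partial quotients agree. -/
theorem eq_of_same_partial_quotients {x y a : ℕ → ℝ} {C : ℝ}
    (ha : ∀ k, 1 ≤ a k) (hx1 : ∀ k, 1 < x k) (hy1 : ∀ k, 1 < y k)
    (hxC : ∀ k, x k ≤ C) (hyC : ∀ k, y k ≤ C)
    (hx : ∀ k, (x k - a k) * x (k + 1) = 1) (hy : ∀ k, (y k - a k) * y (k + 1) = 1) :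
    x 0 = y 0 := by
  have step : ∀ k, |x (k + 1) - y (k + 1)| = |x k - y k| * (x (k + 1) * y (k + 1)) := by
    intro k
    have hpos : 0 < x (k + 1) * y (k + 1) := mul_pos (by linarith [hx1 (k + 1)])
      (by linarith [hy1 (k + 1)])
    rw [← abs_of_pos hpos, ← abs_mul, abs_sub_comm]
    congr 1
    linear_combination x (k + 1) * hy k - y (k + 1) * hx k
  have two (z : ℕ → ℝ) (hz1 : ∀ k, 1 < z k) (hz : ∀ k, (z k - a k) * z (k + 1) = 1) (k : ℕ) :
      2 ≤ z k * z (k + 1) := by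
    nlinarith [hz k, hz1 (k + 1), ha k]
  have grow : ∀ k, 4 ^ k * |x 0 - y 0| ≤ |x (2 * k) - y (2 * k)| := by
    intro k
    induction k with
    | zero => simp
    | succ k ih =>
      have e : |x (2 * (k + 1)) - y (2 * (k + 1))| = |x (2 * k) - y (2 * k)| *
          ((x (2 * k + 1) * x (2 * k + 1 + 1)) * (y (2 * k + 1) * y (2 * k + 1 + 1))) := by
        rw [show 2 * (k + 1) = 2 * k + 1 + 1 by ring, step, step]; ring
      have h4 : 4 ≤ (x (2 * k + 1) * x (2 * k + 1 + 1)) *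
          (y (2 * k + 1) * y (2 * k + 1 + 1)) := by
        nlinarith [two x hx1 hx (2 * k + 1), two y hy1 hy (2 * k + 1)]
      rw [e, pow_succ]
      nlinarith [abs_nonneg (x (2 * k) - y (2 * k))]
  by_contra hne
  have hpos : 0 < |x 0 - y 0| := abs_pos.2 (sub_ne_zero.2 hne)
  obtain ⟨n, hn⟩ := pow_unbounded_of_one_lt (C / |x 0 - y 0|) (by norm_num : (1 : ℝ) < 4)
  rw [div_lt_iff₀ hpos] at hn
  have hle : |x (2 * n) - y (2 * n)| ≤ C := by
    rw [abs_le]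
    constructor <;> linarith [hx1 (2 * n), hy1 (2 * n), hxC (2 * n), hyC (2 * n)]
  linarith [grow n]

theorem irrational_sqrt_of_not_isSquare {f : ℕ} (hns : ¬ IsSquare f) :
    Irrational (√(f : ℝ)) :=
  irrational_sqrt_natCast_iff.2 hns

theorem cfRS_eq_of_cfComplete_eq {f : ℕ} (hf : 0 < f) (hns : ¬ IsSquare f) {i j : ℕ}
    (h : cfComplete f i = cfComplete f j) : cfRS f i = cfRS f j := by
  have hsi := (cfRS_snd_pos_dvd hf hns i).1
  have hsj := (cfRS_snd_pos_dvd hf hns j).1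
  have hi : ((cfRS f i).2 : ℝ) ≠ 0 := by exact_mod_cast hsi.ne'
  have hj : ((cfRS f j).2 : ℝ) ≠ 0 := by exact_mod_cast hsj.ne'
  rw [cfComplete, cfComplete, div_eq_div_iff hi hj] at h
  have hs : (cfRS f i).2 = (cfRS f j).2 := by
    by_contra hne
    have hne' : ((cfRS f j).2 : ℝ) - (cfRS f i).2 ≠ 0 := by
      rw [sub_ne_zero]; exact_mod_cast Ne.symm hne
    refine irrational_sqrt_of_not_isSquare hns
      ⟨((cfRS f j).1 * (cfRS f i).2 - (cfRS f i).1 * (cfRS f j).2 : ℚ) /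
        ((cfRS f j).2 - (cfRS f i).2), ?_⟩
    push_cast
    rw [div_eq_iff hne']
    linear_combination -h
  refine Prod.ext ?_ hs
  rw [hs] at h
  have := mul_right_cancel₀ hj h
  exact_mod_cast add_left_cancel this

theorem cfRS_snd_eq_one_of_isPeriod {f : ℕ} (hf : 0 < f) (hns : ¬ IsSquare f) {p : ℕ}
    (hp : CFIsPeriod f p) : (cfRS f p).2 = 1 ∧ cfRS f (p + 1) = cfRS f 1 := by
  have rel (k : ℕ) : (cfComplete f (k + 1) - cfA f (k + 1)) * cfComplete f (k + 1 + 1) = 1 := by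
    have hpos : 0 < cfComplete f (k + 1 + 1) := by linarith [one_lt_cfComplete hf hns (k + 1)]
    rw [← cfComplete_sub hf hns (k + 1)] at hpos ⊢
    exact mul_inv_cancel₀ (inv_pos.1 hpos).ne'
  have key := eq_of_same_partial_quotients
    (x := fun k => cfComplete f (k + p + 1)) (y := fun k => cfComplete f (k + 1))
    (a := fun k => cfA f (k + 1)) (C := 2 * √f)
    (fun k => by exact_mod_cast cfA_pos hf hns (k + 1))
    (fun k => one_lt_cfComplete hf hns (k + p)) (fun k => one_lt_cfComplete hf hns k)
    (fun k => cfComplete_le hf hns (k + p)) (fun k => cfComplete_le hf hns k)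
    (fun k => by
      have h := rel (k + p)
      rw [show k + p + 1 = k + 1 + p by ring, hp.2 (k + 1) (by omega)] at h
      simpa only [show k + p + 1 = k + 1 + p by ring, show k + 1 + p + 1 = k + 1 + 1 + p by ring]
        using h)
    rel
  simp only [zero_add] at key
  have hst := cfRS_eq_of_cfComplete_eq hf hns key
  refine ⟨?_, hst⟩
  have h := cfRS_mul_succ hf hns p
  rw [hst, cfRS_one] at h
  have hd := natSqrt_sq_lt hns
  exact mul_right_cancel₀ (sub_pos.2 hd).ne' (by simpa using h)

/-- Running the algorithm backwards from the end of a period is the same as running it forwards. -/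
theorem cfRS_reverse {f : ℕ} (hf : 0 < f) (hns : ¬ IsSquare f) {p : ℕ}
    (hp : CFIsPeriod f p) (i j : ℕ) (hij : i + j = p) :
    (cfRS f (i + 1)).1 = (cfRS f (p + j)).1 ∧ (cfRS f i).2 = (cfRS f (p + j)).2 := by
  obtain ⟨h1, h2⟩ := cfRS_snd_eq_one_of_isPeriod hf hns hp
  induction j generalizing i with
  | zero =>
    obtain rfl : i = p := by omega
    obtain ⟨q, rfl⟩ := Nat.exists_eq_add_of_le' hp.1
    exact ⟨by rw [h2, cfRS_one, add_zero, cfRS_fst_of_snd_eq_one hf hns h1], rfl⟩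
  | succ j ih =>
    obtain ⟨e1, e2⟩ := ih (i + 1) (by omega)
    have hA : cfA f (i + 1) = cfA f (p + j) := by
      rw [cfA_eq_fdiv_succ hf hns, e1, e2]
      rfl
    have hr : (cfRS f (i + 1)).1 = (cfRS f (p + (j + 1))).1 := by
      have a1 := cfRS_succ_fst f (i + 1)
      rw [hA, e1, e2] at a1
      rw [← add_assoc, cfRS_succ_fst f (p + j)]
      linarith
    refine ⟨hr, ?_⟩
    have m1 := cfRS_mul_succ hf hns i
    have m2 := cfRS_mul_succ hf hns (p + j)
    rw [hr, e2, ← add_assoc, ← m2, mul_comm] at m1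
    exact mul_left_cancel₀ (cfRS_snd_pos_dvd hf hns (p + j)).1.ne' m1

/-- The partial quotients inside a period form a palindrome. -/
theorem cfA_palindrome {f : ℕ} (hf : 0 < f) (hns : ¬ IsSquare f) {p : ℕ}
    (hp : CFIsPeriod f p) {i j : ℕ} (hi : 1 ≤ i) (hj : 1 ≤ j) (hij : i + j = p) :
    cfA f i = cfA f j := by
  obtain ⟨k, rfl⟩ := Nat.exists_eq_add_of_le' hi
  obtain ⟨e1, e2⟩ := cfRS_reverse hf hns hp (k + 1) j hij
  rw [cfA_eq_fdiv_succ hf hns, e1, e2, ← hp.2 j hj, add_comm j p]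
  rfl

theorem cfNum_add_two (f k : ℕ) :
    cfNum f (k + 2) = cfA f k * cfNum f (k + 1) + cfNum f k := rfl

theorem cfDen_add_two (f k : ℕ) :
    cfDen f (k + 2) = cfA f k * cfDen f (k + 1) + cfDen f k := rfl

/-- Any sequence obeying the recursion of the convergents splits at the centre of a palindrome. -/
theorem eq_mul_cfDen_of_palindrome {f m : ℕ} (z : ℕ → ℤ)
    (hz : ∀ k, z (k + 2) = cfA f k * z (k + 1) + z k)
    (hpal : ∀ i j, 1 ≤ i → 1 ≤ j → i + j = 2 * m + 1 → cfA f i = cfA f j)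
    (i j : ℕ) (hij : i + j = m) :
    z (m + i + 2) * cfDen f (j + 2) + z (m + i + 1) * cfDen f (j + 1) =
      z (m + 2) * cfDen f (m + 2) + z (m + 1) * cfDen f (m + 1) := by
  induction i generalizing j with
  | zero =>
    obtain rfl : j = m := by omega
    rfl
  | succ i ih =>
    rw [← ih (j + 1) (by omega), show m + (i + 1) + 2 = m + i + 1 + 2 by ring, hz,
      cfDen_add_two f (j + 1), hpal (m + i + 1) (j + 1) (by omega) (by omega) (by omega),
      show m + (i + 1) + 1 = m + i + 2 by ring, show m + i + 1 + 1 = m + i + 2 by ring,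
      show j + 1 + 1 = j + 2 by ring]
    ring

theorem eq_of_palindrome {f m : ℕ} (z : ℕ → ℤ)
    (hz : ∀ k, z (k + 2) = cfA f k * z (k + 1) + z k)
    (hpal : ∀ i j, 1 ≤ i → 1 ≤ j → i + j = 2 * m + 1 → cfA f i = cfA f j) :
    z (2 * m + 2) = z (m + 2) * cfDen f (m + 2) + z (m + 1) * cfDen f (m + 1) := by
  rw [← eq_mul_cfDen_of_palindrome z hz hpal m 0 (by ring), two_mul]
  simp [cfDen]

theorem cfNum_cfDen_norm {f : ℕ} (hf : 0 < f) (hns : ¬ IsSquare f) (k : ℕ) :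
    cfNum f (k + 1) ^ 2 - f * cfDen f (k + 1) ^ 2 = (-1) ^ k * (cfRS f k).2 ∧
    cfNum f (k + 1) * cfNum f k - f * cfDen f (k + 1) * cfDen f k =
      -(-1) ^ k * (cfRS f k).1 ∧
    (cfRS f k).2 * (cfNum f k ^ 2 - f * cfDen f k ^ 2) =
      -(-1) ^ k * (f - (cfRS f k).1 ^ 2) := by
  induction k with
  | zero => simp [cfNum, cfDen, cfRS]
  | succ k ih =>
    obtain ⟨h1, h2, h3⟩ := ih
    have hs := (cfRS_snd_pos_dvd hf hns k).1.ne'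
    have hm := cfRS_mul_succ hf hns k
    have hr := cfRS_succ_fst f k
    refine ⟨mul_left_cancel₀ hs ?_, ?_, ?_⟩
    · rw [cfNum_add_two, cfDen_add_two, pow_succ]
      linear_combination cfA f k ^ 2 * (cfRS f k).2 * h1 + 2 * cfA f k * (cfRS f k).2 * h2 + h3
        + (-1) ^ k * hm - (-1) ^ k * ((cfRS f (k + 1)).1 + cfA f k * (cfRS f k).2
          - (cfRS f k).1) * hr
    · rw [cfNum_add_two, cfDen_add_two, pow_succ]
      linear_combination cfA f k * h1 + h2 - (-1) ^ k * hr
    · rw [pow_succ]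
      linear_combination (cfRS f (k + 1)).2 * h1 + (-1) ^ k * hm

theorem cfNum_cfDen_det (f k : ℕ) :
    cfNum f (k + 1) * cfDen f k - cfNum f k * cfDen f (k + 1) = (-1) ^ k := by
  induction k with
  | zero => simp [cfNum, cfDen]
  | succ k ih =>
    rw [cfNum_add_two, cfDen_add_two, pow_succ]
    linear_combination -ih

theorem isCoprime_cfNum_cfDen (f k : ℕ) : IsCoprime (cfNum f (k + 1)) (cfDen f (k + 1)) := by
  refine ⟨(-1) ^ k * cfDen f k, -(-1) ^ k * cfNum f k, ?_⟩
  have h : ((-1 : ℤ) ^ k) * (-1) ^ k = 1 := by rw [← mul_pow]; simp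
  linear_combination (-1) ^ k * cfNum_cfDen_det f k + h

theorem cfNum_pos {f : ℕ} (hf : 0 < f) (hns : ¬ IsSquare f) (k : ℕ) :
    0 < cfNum f (k + 1) ∧ 0 ≤ cfNum f k := by
  induction k with
  | zero => simp [cfNum]
  | succ k ih =>
    refine ⟨?_, ih.1.le⟩
    rw [cfNum_add_two]
    have := mul_pos (cfA_pos hf hns k) ih.1
    linarith [ih.2]

theorem cfDen_pos {f : ℕ} (hf : 0 < f) (hns : ¬ IsSquare f) (k : ℕ) :
    0 < cfDen f (k + 2) ∧ 0 ≤ cfDen f (k + 1) := by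
  induction k with
  | zero => simp [cfDen]
  | succ k ih =>
    refine ⟨?_, ih.1.le⟩
    rw [cfDen_add_two]
    have := mul_pos (cfA_pos hf hns (k + 1)) ih.1
    linarith [ih.2]

theorem cfNum_mono {f : ℕ} (hf : 0 < f) (hns : ¬ IsSquare f) :
    Monotone fun k => cfNum f (k + 1) := by
  refine monotone_nat_of_le_succ fun k => ?_
  obtain ⟨h1, h2⟩ := cfNum_pos hf hns k
  show cfNum f (k + 1) ≤ cfNum f (k + 2)
  rw [cfNum_add_two]
  nlinarith [cfA_pos hf hns k]

theorem convergent_cfComplete_zero {f : ℕ} (hf : 0 < f) (hns : ¬ IsSquare f) (j : ℕ) :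
    (cfComplete f j).convergent 0 = cfA f j := by
  rw [Real.convergent_zero, floor_cfComplete hf hns]

theorem convergent_cfComplete_succ {f : ℕ} (hf : 0 < f) (hns : ¬ IsSquare f) (j n : ℕ) :
    (cfComplete f j).convergent (n + 1) =
      cfA f j + ((cfComplete f (j + 1)).convergent n)⁻¹ := by
  rw [Real.convergent_succ, Int.fract, floor_cfComplete hf hns, cfComplete_sub hf hns]

theorem convergent_cfComplete_pos {f : ℕ} (hf : 0 < f) (hns : ¬ IsSquare f) (j n : ℕ) :
    0 < (cfComplete f j).convergent n := by
  have hA (j : ℕ) : (0 : ℚ) < cfA f j := by exact_mod_cast cfA_pos hf hns j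
  induction n generalizing j with
  | zero => rw [convergent_cfComplete_zero hf hns]; exact hA j
  | succ n ih =>
    rw [convergent_cfComplete_succ hf hns]
    exact add_pos (hA j) (inv_pos.2 (ih _))

theorem convergent_cfComplete_mul {f : ℕ} (hf : 0 < f) (hns : ¬ IsSquare f) (j n : ℕ) :
    ((cfComplete f j).convergent n * cfNum f (j + 1) + cfNum f j) * cfDen f (j + n + 2) =
      cfNum f (j + n + 2) * ((cfComplete f j).convergent n * cfDen f (j + 1) + cfDen f j) := by
  induction n generalizing j with
  | zero =>
    rw [convergent_cfComplete_zero hf hns, add_zero, cfNum_add_two, cfDen_add_two]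
    push_cast
    ring
  | succ n ih =>
    have h := ih (j + 1)
    have hq := (convergent_cfComplete_pos hf hns (j + 1) n).ne'
    rw [convergent_cfComplete_succ hf hns]
    rw [show j + 1 + n + 2 = j + (n + 1) + 2 by ring, show j + 1 + 1 = j + 2 by ring,
      cfNum_add_two f j, cfDen_add_two f j] at h
    push_cast at h
    field_simp
    linear_combination h

theorem cfComplete_zero (f : ℕ) : cfComplete f 0 = √f := by
  simp [cfComplete, cfRS]

theorem convergent_sqrt_mul {f : ℕ} (hf : 0 < f) (hns : ¬ IsSquare f) (n : ℕ) :
    (√(f : ℝ)).convergent n * cfDen f (n + 2) = cfNum f (n + 2) := by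
  have h := convergent_cfComplete_mul hf hns 0 n
  rw [cfComplete_zero] at h
  simpa [cfNum, cfDen] using h

/-- Positive solutions of the negative Pell equation are convergents of `√f`. -/
theorem exists_cfNum_eq_of_negPell {f : ℕ} (hf : 0 < f) (hns : ¬ IsSquare f) {x y : ℤ}
    (hx : 0 < x) (hy : 0 < y) (h : x ^ 2 - f * y ^ 2 = -1) :
    ∃ n, x = cfNum f (n + 2) ∧ y = cfDen f (n + 2) := by
  have hf2 : (2 : ℤ) ≤ f := by exact_mod_cast two_le_of_not_isSquare hf hns
  have hcop : IsCoprime x y := ⟨-x, f * y, by linear_combination -h⟩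
  have hcop' : Nat.Coprime x.natAbs y.natAbs := Int.isCoprime_iff_nat_coprime.1 hcop
  have hden : (((x : ℚ) / y).den : ℤ) = y := Rat.den_div_eq_of_coprime hy hcop'
  have hyx : y ≤ x := by
    by_contra hlt
    nlinarith
  have hyR : (0 : ℝ) < y := by exact_mod_cast hy
  have hyxR : (y : ℝ) ≤ x := by exact_mod_cast hyx
  have hR : (x : ℝ) ^ 2 - f * (y : ℝ) ^ 2 = -1 := by exact_mod_cast h
  have hf2R : (2 : ℝ) ≤ f := by exact_mod_cast hf2
  have hsq : √(f : ℝ) ^ 2 = f := Real.sq_sqrt (Nat.cast_nonneg f)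
  have hs1 : 1 < √(f : ℝ) := Real.lt_sqrt_of_sq_lt (by linarith)
  have hden' : ((((x : ℚ) / y).den : ℕ) : ℝ) = y := by exact_mod_cast hden
  obtain ⟨n, hn⟩ := Real.exists_rat_eq_convergent (ξ := √(f : ℝ)) (q := (x : ℚ) / y) (by
    rw [hden']
    push_cast
    have hprod : (√(f : ℝ) * y - x) * (√(f : ℝ) * y + x) = 1 := by
      linear_combination (y : ℝ) ^ 2 * hsq - hR
    have hsum : 2 * (y : ℝ) < √(f : ℝ) * y + x := by nlinarith
    have hpos : 0 < √(f : ℝ) * y - x := by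
      by_contra hneg
      nlinarith
    rw [show √(f : ℝ) - x / y = (√(f : ℝ) * y - x) / y by field_simp,
      abs_of_pos (div_pos hpos hyR), div_lt_div_iff₀ hyR (by positivity)]
    nlinarith)
  refine ⟨n, ?_⟩
  have hc := convergent_sqrt_mul hf hns n
  have hB := (cfDen_pos hf hns n).1
  have hA := (cfNum_pos hf hns (n + 1)).1
  have hyQ : (y : ℚ) ≠ 0 := by exact_mod_cast hy.ne'
  rw [← hn, div_mul_eq_mul_div, div_eq_iff hyQ] at hc
  have hcZ : x * cfDen f (n + 2) = cfNum f (n + 2) * y := by exact_mod_cast hc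
  have hcop2 := isCoprime_cfNum_cfDen f (n + 1)
  have d1 : x ∣ cfNum f (n + 2) := hcop.dvd_of_dvd_mul_right ⟨_, hcZ.symm⟩
  have d2 : cfNum f (n + 2) ∣ x := hcop2.dvd_of_dvd_mul_right ⟨_, hcZ⟩
  have e := Int.dvd_antisymm hx.le hA.le d1 d2
  refine ⟨e, ?_⟩
  rw [e] at hcZ
  exact (mul_left_cancel₀ hA.ne' hcZ).symm

theorem cfNum_le_of_negPell {f p : ℕ} (hf : 0 < f) (hns : ¬ IsSquare f)
    (hp : CFPeriod f (p + 1)) {x y : ℤ} (hx : 0 < x) (hy : 0 < y)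
    (h : x ^ 2 - f * y ^ 2 = -1) : cfNum f (p + 2) ≤ x := by
  obtain ⟨n, rfl, rfl⟩ := exists_cfNum_eq_of_negPell hf hns hx hy h
  have hN := (cfNum_cfDen_norm hf hns (n + 1)).1
  have hs := (cfRS_snd_pos_dvd hf hns (n + 1)).1
  have h1 : (cfRS f (n + 1)).2 = 1 := by
    rw [h] at hN
    rcases neg_one_pow_eq_or ℤ (n + 1) with e | e <;> rw [e] at hN <;> linarith
  have hle := hp.2 _ (cfIsPeriod_of_snd_eq_one hf hns h1)
  exact cfNum_mono hf hns (show p + 1 ≤ n + 1 from hle)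

/-- The square of the smallest solution of the negative Pell equation is the fundamental solution
of the Pell equation. -/
theorem IsFundamentalPell.eq_of_negPell {f : ℕ} (hf2 : 2 ≤ f) {c h u v : ℤ}
    (hfund : IsFundamentalPell f c h) (hu : 0 < u) (hv : 0 < v)
    (huv : u ^ 2 - f * v ^ 2 = -1)
    (hmin : ∀ x y : ℤ, 0 < x → 0 < y → x ^ 2 - f * y ^ 2 = -1 → u ≤ x) :
    c = 2 * u ^ 2 + 1 ∧ h = 2 * u * v := by
  obtain ⟨hc, hh, hP, hle⟩ := hfund
  have hfZ : (2 : ℤ) ≤ f := by exact_mod_cast hf2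
  have hcle : c ≤ 2 * u ^ 2 + 1 := hle _ (2 * u * v) (by positivity) (by positivity) (by
    linear_combination 4 * u ^ 2 * huv)
  have hceq : c = 2 * u ^ 2 + 1 := by
    refine hcle.antisymm (not_lt.1 fun hlt => ?_)
    have hW0 : 0 < f * h * v := by positivity
    have hW : (f * h * v) ^ 2 = (c ^ 2 - 1) * (u ^ 2 + 1) := by
      linear_combination (-(u ^ 2 + 1)) * hP - f * h ^ 2 * huv
    have hc1 : 1 < c := by
      by_contra hc1
      obtain rfl : c = 1 := by omega
      nlinarith
    have hup : f * h * v < c * u + u := by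
      refine lt_of_pow_lt_pow_left₀ 2 (by positivity) ?_
      rw [hW]
      nlinarith
    have hlo : c * u - u < f * h * v := by
      refine lt_of_pow_lt_pow_left₀ 2 hW0.le ?_
      rw [hW]
      nlinarith [mul_pos hu hu]
    have hnorm : (f * h * v - c * u) ^ 2 - f * (c * v - h * u) ^ 2 = -1 := by
      linear_combination (u ^ 2 - f * v ^ 2) * hP + huv
    have hx : f * h * v - c * u ≠ 0 := by
      intro hx
      rw [hx] at hnorm
      rcases eq_or_ne (c * v - h * u) 0 with hy | hy
      · simp [hy] at hnorm
      · have := sq_pos_of_ne_zero hy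
        nlinarith
    have hy : c * v - h * u ≠ 0 := by
      intro hy
      rw [hy] at hnorm
      nlinarith [sq_nonneg (f * h * v - c * u)]
    have := hmin _ _ (abs_pos.2 hx) (abs_pos.2 hy) (by rwa [sq_abs, sq_abs])
    have habs : |f * h * v - c * u| < u := abs_lt.2 ⟨by linarith, by linarith⟩
    linarith
  refine ⟨hceq, ?_⟩
  have hsq : h ^ 2 = (2 * u * v) ^ 2 := by
    have hf0 : (f : ℤ) ≠ 0 := by linarith
    refine mul_left_cancel₀ hf0 ?_
    rw [hceq] at hP
    linear_combination -hP + 4 * u ^ 2 * huv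
  exact (pow_left_inj₀ hh.le (by positivity) two_ne_zero).1 hsq

theorem stmt_11 (f m : ℕ) (hf : 0 < f) (hns : ¬ IsSquare f)
    (hper : CFPeriod f (2 * m + 1)) (c h : ℤ) (hfund : IsFundamentalPell f c h) :
    c = 2 * (cfNum f (m + 2) * cfDen f (m + 2) + cfNum f (m + 1) * cfDen f (m + 1)) ^ 2 + 1 ∧
      h = 2 * (cfNum f (m + 2) * cfDen f (m + 2) + cfNum f (m + 1) * cfDen f (m + 1)) *
        (cfDen f (m + 2) ^ 2 + cfDen f (m + 1) ^ 2) := by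
  have hpal : ∀ i j, 1 ≤ i → 1 ≤ j → i + j = 2 * m + 1 → cfA f i = cfA f j :=
    fun i j => cfA_palindrome hf hns hper.1
  rw [← eq_of_palindrome (cfNum f) (cfNum_add_two f) hpal, sq (cfDen f (m + 2)),
    sq (cfDen f (m + 1)), ← eq_of_palindrome (cfDen f) (cfDen_add_two f) hpal]
  have hN := (cfNum_cfDen_norm hf hns (2 * m + 1)).1
  rw [(cfRS_snd_eq_one_of_isPeriod hf hns hper.1).1, pow_succ (-1), pow_mul] at hN
  exact hfund.eq_of_negPell (two_le_of_not_isSquare hf hns) (cfNum_pos hf hns _).1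
    (cfDen_pos hf hns _).1 (by simpa using hN)
    fun x y hx hy h => cfNum_le_of_negPell hf hns hper hx hy h
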